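/- arXiv:2011.04662 — 4 statements merged into one kernel-verified Lean document; each statement's English description precedes it below -/
import Mathlib

section
/- For every real number γ and all integers m, n, k, the commutator of the fractional Witt generators satisfies [L_m^γ, L_n^γ](δ_k) = (Γ₀^γ(k+m) − Γ₀^γ(k+n)) · L_{m+n}^γ(δ_k); equivalently, (L_m^γ ∘ L_n^γ − L_n^γ ∘ L_m^γ)(δ_k) = −Γ₀^γ(k)·(Γ₀^γ(k+m) − Γ₀^γ(k+n))·δ_{k+m+n}. -/
/-- `Γ₀^γ(k) = Γ(1+γk)/Γ(1+γ(k−1))`, with `Γ` the real Gamma function. -/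
noncomputable def Gamma0 (γ : ℝ) (k : ℤ) : ℝ :=
  Real.Gamma (1 + γ * k) / Real.Gamma (1 + γ * (k - 1))

/-- For every real `γ` and all integers `m, n, k`, if `L j` denotes the ℂ-linear
endomorphism of `V = ℤ →₀ ℂ` modelling the fractional Witt generator `L_j^γ`,
i.e. `L j (δ_i) = −Γ₀^γ(i) • δ_{i+j}`, then the commutator satisfies
`[L_m, L_n](δ_k) = (Γ₀^γ(k+m) − Γ₀^γ(k+n)) • L_{m+n}(δ_k)`, equivalently
`(L_m ∘ L_n − L_n ∘ L_m)(δ_k) = −Γ₀^γ(k)·(Γ₀^γ(k+m) − Γ₀^γ(k+n)) • δ_{k+m+n}`. -/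
theorem fractional_witt_commutator (γ : ℝ) (m n k : ℤ)
    (L : ℤ → ((ℤ →₀ ℂ) →ₗ[ℂ] (ℤ →₀ ℂ)))
    (hL : ∀ j i : ℤ, L j (Finsupp.single i (1 : ℂ)) =
      (-(Gamma0 γ i : ℂ)) • Finsupp.single (i + j) (1 : ℂ)) :
    (L m ∘ₗ L n - L n ∘ₗ L m) (Finsupp.single k (1 : ℂ)) =
      ((Gamma0 γ (k + m) : ℂ) - (Gamma0 γ (k + n) : ℂ)) •
        L (m + n) (Finsupp.single k (1 : ℂ)) ∧
    (L m ∘ₗ L n - L n ∘ₗ L m) (Finsupp.single k (1 : ℂ)) =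
      (-(Gamma0 γ k : ℂ) * ((Gamma0 γ (k + m) : ℂ) - (Gamma0 γ (k + n) : ℂ))) •
        Finsupp.single (k + m + n) (1 : ℂ) := by
  have key : (L m ∘ₗ L n - L n ∘ₗ L m) (Finsupp.single k (1 : ℂ)) =
      (-(Gamma0 γ k : ℂ) * ((Gamma0 γ (k + m) : ℂ) - (Gamma0 γ (k + n) : ℂ))) •
        Finsupp.single (k + m + n) (1 : ℂ) := by
    simp only [LinearMap.sub_apply, LinearMap.comp_apply, hL, map_smul, smul_smul,
      add_right_comm k n m, ← sub_smul]
    congr 1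
    ring
  refine ⟨?_, key⟩
  rw [key, hL, smul_smul, mul_comm, add_assoc]
end

section
/- For every real number γ, all functions φ, ψ : ℤ → ℂ, and all integers m, n, the commutator of the twisted generators is again a twisted generator: T_{φ,m} ∘ T_{ψ,n} − T_{ψ,n} ∘ T_{φ,m} = T_{[φ,ψ]_{m,n}, m+n} as ℂ-linear endomorphisms of V. -/
/-- The fractional bracket `[φ,ψ]_{m,n}(s) = ψ(m+s)·φ(s)·Γ₀^γ(s+m) − ψ(s)·φ(n+s)·Γ₀^γ(s+n)`. -/
noncomputable def fbracket (γ : ℝ) (φ ψ : ℤ → ℂ) (m n : ℤ) : ℤ → ℂ := fun s =>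
  ψ (m + s) * φ s * (Gamma0 γ (s + m) : ℂ) - ψ s * φ (n + s) * (Gamma0 γ (s + n) : ℂ)

/-- For every real `γ`, all `φ, ψ : ℤ → ℂ` and all integers `m, n`: if `T f j`
denotes the ℂ-linear endomorphism of `V = ℤ →₀ ℂ` modelling the twisted generator
`f ⊗ L_j^γ`, i.e. `T f j (δ_i) = −f(i)·Γ₀^γ(i) • δ_{i+j}`, then the commutator of
twisted generators is again a twisted generator:
`T_{φ,m} ∘ T_{ψ,n} − T_{ψ,n} ∘ T_{φ,m} = T_{[φ,ψ]_{m,n}, m+n}`. -/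
theorem twisted_generator_commutator (γ : ℝ) (φ ψ : ℤ → ℂ) (m n : ℤ)
    (T : (ℤ → ℂ) → ℤ → ((ℤ →₀ ℂ) →ₗ[ℂ] (ℤ →₀ ℂ)))
    (hT : ∀ (f : ℤ → ℂ) (j i : ℤ), T f j (Finsupp.single i (1 : ℂ)) =
      (-(f i * (Gamma0 γ i : ℂ))) • Finsupp.single (i + j) (1 : ℂ)) :
    T φ m ∘ₗ T ψ n - T ψ n ∘ₗ T φ m = T (fbracket γ φ ψ m n) (m + n) := by
  ext1 k
  refine LinearMap.ext_ring ?_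
  have hadd : k + (m + n) = k + n + m := by ring
  have hadd' : k + m + n = k + n + m := by ring
  simp only [LinearMap.comp_apply, LinearMap.sub_apply, Finsupp.lsingle_apply, hT, map_smul,
    smul_smul, hadd, hadd', ← sub_smul]
  congr 1
  simp only [fbracket, add_comm m k, add_comm n k]
  ring
end

section
/- For every real number γ, the ℂ-linear span of the set of operators { T_{φ,n} : φ : ℤ → ℂ, n ∈ ℤ } inside the endomorphism algebra of V is closed under the commutator bracket, i.e., it is a Lie subalgebra of End(V) with its commutator Lie structure. (This is the concrete realization of the identification of the fractional Witt algebra W_γ with H ⊗ W.) -/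
/-- The product of two twisted generators is again a twisted generator. -/
theorem twisted_generator_mul (γ : ℝ)
    (T : (ℤ → ℂ) → ℤ → Module.End ℂ (ℤ →₀ ℂ))
    (hT : ∀ (f : ℤ → ℂ) (j i : ℤ), T f j (Finsupp.single i (1 : ℂ)) =
      (-(f i * (Gamma0 γ i : ℂ))) • Finsupp.single (i + j) (1 : ℂ))
    (φ ψ : ℤ → ℂ) (n m : ℤ) :
    T φ n * T ψ m = T (fun k ↦ -(ψ k * φ (k + m) * (Gamma0 γ (k + m) : ℂ))) (m + n) := by
  refine Finsupp.lhom_ext' fun k ↦ LinearMap.ext_ring ?_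
  simp only [LinearMap.comp_apply, Finsupp.lsingle_apply, Module.End.mul_apply, hT, map_smul,
    smul_smul, add_assoc]
  congr 1
  ring

/-- For every real `γ`: if `T f j` denotes the ℂ-linear endomorphism of
`V = ℤ →₀ ℂ` modelling the twisted generator `f ⊗ L_j^γ`, i.e.
`T f j (δ_i) = −f(i)·Γ₀^γ(i) • δ_{i+j}`, then the ℂ-linear span of
`{ T φ n | φ : ℤ → ℂ, n ∈ ℤ }` inside `End(V)` is closed under the commutator
bracket, i.e. it is a Lie subalgebra of `End(V)` with its commutator Lie
structure (the concrete realization of `W_γ ≅ H ⊗ W`). -/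
theorem span_twisted_generators_closed_under_bracket (γ : ℝ)
    (T : (ℤ → ℂ) → ℤ → Module.End ℂ (ℤ →₀ ℂ))
    (hT : ∀ (f : ℤ → ℂ) (j i : ℤ), T f j (Finsupp.single i (1 : ℂ)) =
      (-(f i * (Gamma0 γ i : ℂ))) • Finsupp.single (i + j) (1 : ℂ))
    (A B : Module.End ℂ (ℤ →₀ ℂ))
    (hA : A ∈ Submodule.span ℂ {E : Module.End ℂ (ℤ →₀ ℂ) | ∃ φ n, E = T φ n})
    (hB : B ∈ Submodule.span ℂ {E : Module.End ℂ (ℤ →₀ ℂ) | ∃ φ n, E = T φ n}) :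
    ⁅A, B⁆ ∈ Submodule.span ℂ {E : Module.End ℂ (ℤ →₀ ℂ) | ∃ φ n, E = T φ n} := by
  have mul_mem {A B : Module.End ℂ (ℤ →₀ ℂ)}
      (hA : A ∈ Submodule.span ℂ {E : Module.End ℂ (ℤ →₀ ℂ) | ∃ φ n, E = T φ n})
      (hB : B ∈ Submodule.span ℂ {E : Module.End ℂ (ℤ →₀ ℂ) | ∃ φ n, E = T φ n}) :
      A * B ∈ Submodule.span ℂ {E : Module.End ℂ (ℤ →₀ ℂ) | ∃ φ n, E = T φ n} := by
    have h := Submodule.mul_mem_mul hA hB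
    rw [Submodule.span_mul_span] at h
    refine Submodule.span_mono ?_ h
    rintro _ ⟨_, ⟨φ, n, rfl⟩, _, ⟨ψ, m, rfl⟩, rfl⟩
    exact ⟨_, _, twisted_generator_mul γ T hT φ ψ n m⟩
  have h : ⁅A, B⁆ = A * B + (-1 : ℂ) • (B * A) := by
    refine LinearMap.ext fun v ↦ ?_
    rw [Ring.lie_def, LinearMap.sub_apply, LinearMap.add_apply, LinearMap.smul_apply,
      neg_one_smul, sub_eq_add_neg]
  rw [h]
  exact Submodule.add_mem _ (mul_mem hA hB) (Submodule.smul_mem _ _ (mul_mem hB hA))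
end

section
/- The fractional bracket satisfies the Jacobi identity: for every real number γ, all functions φ, ψ, χ : ℤ → ℂ, and all integers m, n, p, s, one has [[φ,ψ]_{m,n}, χ]_{m+n,p}(s) + [[ψ,χ]_{n,p}, φ]_{n+p,m}(s) + [[χ,φ]_{p,m}, ψ]_{p+m,n}(s) = 0. -/
/-- The fractional bracket satisfies the Jacobi identity: for every real `γ`,
all `φ, ψ, χ : ℤ → ℂ` and all integers `m, n, p, s`,
`[[φ,ψ]_{m,n}, χ]_{m+n,p}(s) + [[ψ,χ]_{n,p}, φ]_{n+p,m}(s) + [[χ,φ]_{p,m}, ψ]_{p+m,n}(s) = 0`. -/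
theorem fbracket_jacobi (γ : ℝ) (φ ψ χ : ℤ → ℂ) (m n p s : ℤ) :
    fbracket γ (fbracket γ φ ψ m n) χ (m + n) p s +
    fbracket γ (fbracket γ ψ χ n p) φ (n + p) m s +
    fbracket γ (fbracket γ χ φ p m) ψ (p + m) n s = 0 := by
  simp only [fbracket]
  ring_nf
end
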